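/- arXiv:2510.09139 — 4 statements merged into one kernel-verified Lean document; each statement's English description precedes it below -/
import Mathlib

section
/- Let R be a commutative ring and let A be an ι×κ matrix and B a κ×μ matrix over R (ι, κ, μ finite) with A * B = 0. Let g : κ' → κ be an injective map and f : ι' → ι, h : μ' → μ arbitrary maps such that for every p' : ι' and i' : μ', every index j : κ with A (f p') j ≠ 0 and B j (h i') ≠ 0 lies in the range of g. Then the submatrix product (A.submatrix f g) * (B.submatrix g h) = 0. -/
open Matrix

/-- Proposition 1 (core): orthogonality of boundary matrices is preserved under
restriction to a sub-family of cells, provided every intermediate cell incident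
both to a selected lower cell and a selected upper cell is itself selected. -/
theorem submatrix_mul_eq_zero_of_mul_eq_zero
    {R : Type*} [CommRing R]
    {ι κ μ ι' κ' μ' : Type*} [Fintype ι] [Fintype κ] [Fintype μ] [Fintype κ']
    (A : Matrix ι κ R) (B : Matrix κ μ R) (hAB : A * B = 0)
    (g : κ' → κ) (hg : Function.Injective g)
    (f : ι' → ι) (h : μ' → μ)
    (hcover : ∀ (p' : ι') (i' : μ') (j : κ),
      A (f p') j ≠ 0 → B j (h i') ≠ 0 → j ∈ Set.range g) :
    (A.submatrix f g) * (B.submatrix g h) = 0 := by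
  ext p i
  have h0 : ∑ j, A (f p) j * B j (h i) = 0 := by
    have := congrFun (congrFun hAB (f p)) (h i)
    simpa [Matrix.mul_apply] using this
  simp only [Matrix.mul_apply, Matrix.submatrix_apply, Matrix.zero_apply]
  rw [← h0]
  refine Fintype.sum_of_injective g hg _ _ ?_ (fun _ => rfl)
  intro j hj
  by_cases hA : A (f p) j = 0
  · rw [hA, zero_mul]
  · by_cases hB : B j (h i) = 0
    · rw [hB, mul_zero]
    · exact absurd (hcover p i j hA hB) hj
end

section
/- Let B be an N×E real matrix such that every column j has exactly one nonzero entry, and that entry equals 1 or −1. Then the dimension of the kernel of the linear map x ↦ (B Bᵀ) x on ℝ^N equals the number of rows i of B that are identically zero. -/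
open Matrix

/-- If every column of B has exactly one nonzero entry, equal to ±1, then
dim ker(BBᵀ·) equals the number of identically zero rows of B. -/
theorem finrank_ker_incidence_laplacian
    {N E : ℕ} (B : Matrix (Fin N) (Fin E) ℝ)
    (hcol : ∀ j : Fin E, ∃! i : Fin N, B i j ≠ 0)
    (hval : ∀ (i : Fin N) (j : Fin E), B i j ≠ 0 → B i j = 1 ∨ B i j = -1) :
    Module.finrank ℝ (LinearMap.ker (B * Bᵀ).mulVecLin)
      = ({i : Fin N | ∀ j : Fin E, B i j = 0} : Set (Fin N)).ncard := by
  classical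
  have hd : B * Bᵀ = Matrix.diagonal (fun i => ∑ j, B i j ^ 2) := by
    ext i k
    rw [Matrix.mul_apply]
    by_cases h : i = k
    · subst h
      simp [pow_two]
    · rw [Matrix.diagonal_apply_ne _ h]
      refine Finset.sum_eq_zero fun j _ => ?_
      rw [Matrix.transpose_apply]
      by_contra hne
      exact h ((hcol j).unique (left_ne_zero_of_mul hne) (right_ne_zero_of_mul hne))
  have hw : ∀ i, (∑ j, B i j ^ 2 = 0) ↔ ∀ j, B i j = 0 := by
    intro i
    rw [Finset.sum_eq_zero_iff_of_nonneg (fun j _ => sq_nonneg _)]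
    simp
  have h1 := LinearMap.finrank_range_add_finrank_ker (B * Bᵀ).mulVecLin
  have h2 : Module.finrank ℝ (LinearMap.range (B * Bᵀ).mulVecLin)
      = Fintype.card {i // (∑ j, B i j ^ 2) ≠ 0} := by
    have := Matrix.rank_diagonal (fun i => ∑ j, B i j ^ 2)
    rw [← hd] at this
    exact this
  have h3 := Fintype.card_subtype_compl (fun i : Fin N => (∑ j, B i j ^ 2) = 0)
  have h4 := Fintype.card_subtype_le (fun i : Fin N => (∑ j, B i j ^ 2) = 0)
  have h5 : ({i : Fin N | ∀ j : Fin E, B i j = 0} : Set (Fin N)).ncard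
      = Fintype.card {i // (∑ j, B i j ^ 2) = 0} := by
    rw [← Nat.card_coe_set_eq, ← Nat.card_eq_fintype_card]
    exact Nat.card_congr (Equiv.subtypeEquivRight fun i => (hw i).symm)
  simp only [Module.finrank_fin_fun, Fintype.card_fin, ne_eq] at *
  omega
end

section
/- Let B₀₀ be an n×N₀₀ real matrix such that every column has exactly one nonzero entry equal to 1 or −1, and let n₀ denote the number of nonzero rows of B₀₀. Let B₁₀ be an N₀₀×N₁₀ real matrix with linearly independent columns, satisfying B₀₀ * B₁₀ = 0. Define the (0,0)-cross-Laplacian L₀₀ = B₀₀ᵀB₀₀ + B₁₀B₁₀ᵀ. Then the dimension of the kernel of the linear map x ↦ L₀₀ x on ℝ^{N₀₀} equals N₀₀ − n₀ − N₁₀. -/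
open Matrix

/-- Theorem 1 (linear-algebraic content): the cross-Betti number
dim ker(L₀₀·) equals N₀₀ − n₀ − N₁₀, where n₀ is the number of nonzero rows of
the node/cross-edge incidence matrix B₀₀ and N₁₀ the number of (linearly
independent) columns of the cross-cell incidence matrix B₁₀. -/
theorem cross_betti_number
    {n N₀₀ N₁₀ : ℕ}
    (B₀₀ : Matrix (Fin n) (Fin N₀₀) ℝ)
    (hcol : ∀ j : Fin N₀₀, ∃! i : Fin n, B₀₀ i j ≠ 0)
    (hval : ∀ (i : Fin n) (j : Fin N₀₀), B₀₀ i j ≠ 0 → B₀₀ i j = 1 ∨ B₀₀ i j = -1)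
    (n₀ : ℕ)
    (hn₀ : n₀ = ({i : Fin n | ∃ j : Fin N₀₀, B₀₀ i j ≠ 0} : Set (Fin n)).ncard)
    (B₁₀ : Matrix (Fin N₀₀) (Fin N₁₀) ℝ)
    (hli : LinearIndependent ℝ (fun k : Fin N₁₀ => (fun i => B₁₀ i k : Fin N₀₀ → ℝ)))
    (horth : B₀₀ * B₁₀ = 0) :
    Module.finrank ℝ (LinearMap.ker (B₀₀ᵀ * B₀₀ + B₁₀ * B₁₀ᵀ).mulVecLin)
      = N₀₀ - n₀ - N₁₀ := by
  classical
  let S := {i : Fin n // ∃ j : Fin N₀₀, B₀₀ i j ≠ 0}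
  let C : Matrix (S ⊕ Fin N₁₀) (Fin N₀₀) ℝ :=
    Matrix.fromRows (B₀₀.submatrix (Subtype.val : S → Fin n) id) B₁₀ᵀ
  have hL : B₀₀ᵀ * B₀₀ + B₁₀ * B₁₀ᵀ = Cᵀ * C := by
    ext a b
    simp only [Matrix.add_apply, Matrix.mul_apply, Matrix.transpose_apply,
      Fintype.sum_sum_type, C, Matrix.fromRows_apply_inl, Matrix.fromRows_apply_inr,
      Matrix.submatrix_apply, id]
    congr 1
    symm
    have h1 := Finset.sum_subtype (F := inferInstanceAs (Fintype S)) (p := fun i => ∃ j : Fin N₀₀, B₀₀ i j ≠ 0)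
      (Finset.univ.filter (fun i => ∃ j : Fin N₀₀, B₀₀ i j ≠ 0)) (by simp)
      (fun i => B₀₀ i a * B₀₀ i b)
    refine h1.symm.trans ?_
    apply Finset.sum_subset (Finset.subset_univ _)
    intro i _ hi
    have h0 : B₀₀ i a = 0 := by
      by_contra hc
      exact hi (by simpa using ⟨a, hc⟩)
    rw [h0, zero_mul]
  have hrow : LinearIndependent ℝ C.row := by
    rw [Fintype.linearIndependent_iff]
    intro g hg
    have e : ∀ j, ∑ i : S, g (Sum.inl i) * B₀₀ i.1 j
        + ∑ k, g (Sum.inr k) * B₁₀ j k = 0 := by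
      intro j
      have := congrFun hg j
      simpa [C, Fintype.sum_sum_type, Finset.sum_apply, Matrix.row] using this
    -- pair with the columns of B₁₀
    have hz : B₁₀ᵀ *ᵥ (B₁₀ *ᵥ (fun k => g (Sum.inr k))) = 0 := by
      have h1 : B₁₀ *ᵥ (fun k => g (Sum.inr k))
          = fun j => - ∑ i : S, g (Sum.inl i) * B₀₀ i.1 j := by
        ext j
        have := e j
        simp only [Matrix.mulVec, dotProduct]
        simp only [mul_comm (B₁₀ j _)]
        linarith
      rw [h1]
      ext k
      simp only [Matrix.mulVec, dotProduct, Matrix.transpose_apply, Pi.zero_apply, mul_neg,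
        Finset.mul_sum, Finset.sum_neg_distrib]
      rw [Finset.sum_comm, neg_eq_zero]
      apply Finset.sum_eq_zero
      intro i _
      have h2 : ∑ j, B₀₀ i.1 j * B₁₀ j k = 0 := by
        have := congrFun (congrFun horth i.1) k
        simpa [Matrix.mul_apply] using this
      calc _ = g (Sum.inl i) * ∑ j, B₀₀ i.1 j * B₁₀ j k := by
            rw [Finset.mul_sum]; exact Finset.sum_congr rfl fun j _ => by ring
        _ = 0 := by rw [h2, mul_zero]
    have hz2 : B₁₀ *ᵥ (fun k => g (Sum.inr k)) = 0 := by
      have : (fun k => g (Sum.inr k)) ∈ LinearMap.ker (B₁₀ᵀ * B₁₀).mulVecLin := by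
        rw [LinearMap.mem_ker, Matrix.mulVecLin_apply, ← Matrix.mulVec_mulVec]
        exact hz
      rw [Matrix.ker_mulVecLin_transpose_mul_self] at this
      simpa using this
    have hb : ∀ k, g (Sum.inr k) = 0 := by
      apply Fintype.linearIndependent_iff.mp hli (fun k => g (Sum.inr k))
      ext j
      have := congrFun hz2 j
      simpa [Matrix.mulVec, dotProduct, mul_comm, Finset.sum_apply] using this
    rintro (i | k)
    · obtain ⟨j, hj⟩ := i.2
      have h := e j
      simp only [hb, zero_mul, Finset.sum_const_zero, add_zero] at h
      rw [Finset.sum_eq_single i] at h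
      · exact (mul_eq_zero.mp h).resolve_right hj
      · intro i' _ hne
        by_contra hc
        exact hne (Subtype.ext ((hcol j).unique (right_ne_zero_of_mul hc) hj))
      · simp
    · exact hb k
  have hrank : (Cᵀ * C).rank = n₀ + N₁₀ := by
    rw [Matrix.rank_transpose_mul_self, hrow.rank_matrix, Fintype.card_sum, Fintype.card_fin, hn₀,
      ← Nat.card_coe_set_eq, ← Nat.card_eq_fintype_card]
    rfl
  have hrn := LinearMap.finrank_range_add_finrank_ker (Cᵀ * C).mulVecLin
  rw [Module.finrank_fin_fun] at hrn
  rw [Matrix.rank] at hrank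
  rw [hL]
  omega
end

section
/- Let B be an n×e real matrix and C an e×c real matrix with B * C = 0, and let y ∈ ℝ^e. Suppose P is an n×n real matrix satisfying the four Moore–Penrose conditions for BBᵀ (i.e., BBᵀ·P·BBᵀ = BBᵀ, P·BBᵀ·P = P, (BBᵀ·P)ᵀ = BBᵀ·P, (P·BBᵀ)ᵀ = P·BBᵀ), and Q is a c×c real matrix satisfying the four Moore–Penrose conditions for CᵀC. Define s₀ = P (B y), s₂ = Q (Cᵀ y), and h = y − Bᵀ s₀ − C s₂. Then B h = 0 and Cᵀ h = 0, and consequently (s₀, s₂, h) is a global minimizer of ‖Bᵀ s₀' + C s₂' + h' − y‖² over all s₀' ∈ ℝⁿ, s₂' ∈ ℝᶜ, h' ∈ ℝᵉ subject to B h' = 0 and Cᵀ h' = 0, the minimum value being 0. -/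
open Matrix

/-- If `P` is an inner inverse of `A Aᵀ`, then `A Aᵀ P A = A`. -/
theorem gram_inner_inverse {n e : ℕ} (A : Matrix (Fin n) (Fin e) ℝ)
    (P : Matrix (Fin n) (Fin n) ℝ)
    (hP : (A * Aᵀ) * P * (A * Aᵀ) = A * Aᵀ) : (A * Aᵀ) * P * A = A := by
  have h1 : ((A * Aᵀ) * P - 1) * (A * Aᴴ) = 0 := by
    rw [conjTranspose_eq_transpose_of_trivial, Matrix.sub_mul, hP, Matrix.one_mul, sub_self]
  rw [Matrix.mul_self_mul_conjTranspose_eq_zero, Matrix.sub_mul, Matrix.one_mul] at h1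
  exact sub_eq_zero.mp h1

/-- Closed-form solution of the estimation problem: with B C = 0, pseudoinverse
matrices P of BBᵀ and Q of CᵀC, the signals s₀ = P B y, s₂ = Q Cᵀ y and
h = y − Bᵀ s₀ − C s₂ satisfy B h = 0 and Cᵀ h = 0, and (s₀, s₂, h) globally
minimizes ‖Bᵀ s₀' + C s₂' + h' − y‖² over the constraint set, the minimum
value being 0. -/
theorem closed_form_estimation
    {n e c : ℕ} (B : Matrix (Fin n) (Fin e) ℝ) (C : Matrix (Fin e) (Fin c) ℝ)
    (hBC : B * C = 0) (y : Fin e → ℝ)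
    (P : Matrix (Fin n) (Fin n) ℝ)
    (hP1 : (B * Bᵀ) * P * (B * Bᵀ) = B * Bᵀ)
    (hP2 : P * (B * Bᵀ) * P = P)
    (hP3 : ((B * Bᵀ) * P)ᵀ = (B * Bᵀ) * P)
    (hP4 : (P * (B * Bᵀ))ᵀ = P * (B * Bᵀ))
    (Q : Matrix (Fin c) (Fin c) ℝ)
    (hQ1 : (Cᵀ * C) * Q * (Cᵀ * C) = Cᵀ * C)
    (hQ2 : Q * (Cᵀ * C) * Q = Q)
    (hQ3 : ((Cᵀ * C) * Q)ᵀ = (Cᵀ * C) * Q)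
    (hQ4 : (Q * (Cᵀ * C))ᵀ = Q * (Cᵀ * C)) :
    let s₀ := P.mulVec (B.mulVec y)
    let s₂ := Q.mulVec (Cᵀ.mulVec y)
    let h := y - Bᵀ.mulVec s₀ - C.mulVec s₂
    let obj : (Fin n → ℝ) → (Fin c → ℝ) → (Fin e → ℝ) → ℝ :=
      fun s₀' s₂' h' => ∑ i, (Bᵀ.mulVec s₀' + C.mulVec s₂' + h' - y) i ^ 2
    B.mulVec h = 0 ∧ Cᵀ.mulVec h = 0 ∧
    obj s₀ s₂ h = 0 ∧
    (∀ (s₀' : Fin n → ℝ) (s₂' : Fin c → ℝ) (h' : Fin e → ℝ),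
      B.mulVec h' = 0 → Cᵀ.mulVec h' = 0 → obj s₀ s₂ h ≤ obj s₀' s₂' h') := by
  intro s₀ s₂ h obj
  have hB := gram_inner_inverse B P hP1
  have hC := gram_inner_inverse Cᵀ Q (by simpa using hQ1)
  rw [transpose_transpose] at hC
  have hCB : Cᵀ * Bᵀ = 0 := by rw [← transpose_mul, hBC, transpose_zero]
  have h0 : obj s₀ s₂ h = 0 := by
    have hz : Bᵀ.mulVec s₀ + C.mulVec s₂ + h - y = 0 := by
      simp only [h]; abel
    simp only [obj, hz]
    simp
  refine ⟨?_, ?_, h0, ?_⟩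
  · simp only [h, s₀, s₂, mulVec_sub, mulVec_mulVec]
    simp only [← Matrix.mul_assoc, hBC, Matrix.zero_mul, hB]
    simp
  · simp only [h, s₀, s₂, mulVec_sub, mulVec_mulVec]
    simp only [← Matrix.mul_assoc, hCB, Matrix.zero_mul, hC]
    simp
  · intro a b d _ _
    rw [h0]
    exact Finset.sum_nonneg fun i _ => sq_nonneg _
end
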